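/- Let q be a prime power and F_q the finite field with q elements. Let d ≥ 2, let E ⊆ F_q^d, fix 1 ≤ j ≤ d and a nonzero z ∈ F_q such that z is the j-th coordinate of some point of E, and let C > 0. If |E^j_z| · |E| ≥ C q^d, then the pinned dot-product set satisfies |{x·y : x ∈ E^j_z, y ∈ E}| ≥ (C/(C+2)) · q. -/

import Mathlib

open Finset in
/-- Cauchy–Schwarz: a map into `T` has at least `|s|² / |T|` collisions on `s`. -/
theorem card_sq_le_card_mul_card_collisions {α β : Type*} [DecidableEq β]
    (s : Finset α) (T : Finset β) (f : α → β) (hf : ∀ a ∈ s, f a ∈ T) :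
    s.card ^ 2 ≤ T.card * ((s ×ˢ s).filter fun p => f p.1 = f p.2).card := by
  have hcoll : ((s ×ˢ s).filter fun p => f p.1 = f p.2).card =
      ∑ t ∈ T, (s.filter fun a => f a = t).card ^ 2 := by
    rw [card_eq_sum_card_fiberwise (f := fun p => f p.1) (t := T)
      (fun p hp => hf _ (mem_product.1 (mem_filter.1 hp).1).1)]
    refine sum_congr rfl fun t _ => ?_
    rw [sq, ← card_product]
    congr 1
    ext p
    simp only [mem_filter, mem_product]
    grind
  rw [hcoll, card_eq_sum_card_fiberwise hf]
  exact sq_sum_le_card_mul_sum_sq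

open Finset in
/-- A coordinate hyperplane in `F ^ ι` has at most a fraction `1 / |F|` of all points. -/
theorem card_mul_card_coord_eq_le {F ι : Type*} [Fintype F] [DecidableEq F] [Fintype ι]
    [DecidableEq ι] (j : ι) (z : F) :
    Fintype.card F * (univ.filter fun x : ι → F => x j = z).card ≤
      Fintype.card F ^ Fintype.card ι := by
  rw [← Fintype.card_fun, ← card_univ, ← card_univ, ← card_product]
  refine card_le_card_of_injOn (fun p => Function.update p.2 j p.1)
    (fun _ _ => mem_coe.2 (mem_univ _)) ?_
  rintro ⟨s, x⟩ hx ⟨t, y⟩ hy h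
  simp only [coe_product, Set.mem_prod, mem_coe, mem_filter, mem_univ, true_and] at hx hy h
  refine Prod.ext (by simpa using congrFun h j) (funext fun i => ?_)
  by_cases hi : i = j
  · rw [hi]; exact hx.trans hy.symm
  · simpa [hi] using congrFun h i

section Hyperplane

open Finset Matrix

variable {F ι : Type*} [Field F] [Fintype F] [DecidableEq F] [Fintype ι] [DecidableEq ι]

/-- A non-vertical linear condition cuts out at most a fraction `1 / |F|` of a coordinate
hyperplane. -/
theorem card_mul_card_coord_eq_dotProduct_eq_zero_le (j : ι) (z : F) (v : ι → F) {i : ι}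
    (hij : i ≠ j) (hv : v i ≠ 0) :
    Fintype.card F * (univ.filter fun x : ι → F => x j = z ∧ x ⬝ᵥ v = 0).card ≤
      (univ.filter fun x : ι → F => x j = z).card := by
  rw [← card_univ, ← card_product]
  refine card_le_card_of_injOn (fun p => p.2 + Pi.single i p.1) ?_ ?_
  · rintro ⟨s, x⟩ hx
    simp only [coe_product, Set.mem_prod, mem_coe, mem_filter, mem_univ, true_and] at hx ⊢
    simp [hx.1, hij.symm]
  · rintro ⟨s, x⟩ hx ⟨t, y⟩ hy h
    simp only [coe_product, Set.mem_prod, mem_coe, mem_filter, mem_univ, true_and] at hx hy h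
    have hst : s = t := by
      have := congrArg (· ⬝ᵥ v) h
      simpa [add_dotProduct, hx.2, hy.2, hv] using this
    subst hst
    simpa using h

/-- For `y ≠ y'`, the equation `x ⬝ᵥ y = x ⬝ᵥ y'` holds on at most a fraction `1 / |F|` of a
coordinate hyperplane avoiding the origin. -/
theorem card_mul_card_coord_eq_dotProduct_eq_le (j : ι) {z : F} (hz : z ≠ 0) {y y' : ι → F}
    (hy : y ≠ y') :
    Fintype.card F * (univ.filter fun x : ι → F => x j = z ∧ x ⬝ᵥ y = x ⬝ᵥ y').card ≤
      (univ.filter fun x : ι → F => x j = z).card := by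
  have hsub (x : ι → F) : x ⬝ᵥ y = x ⬝ᵥ y' ↔ x ⬝ᵥ (y - y') = 0 := by
    rw [dotProduct_sub, sub_eq_zero]
  simp only [hsub]
  by_cases h : ∃ i, i ≠ j ∧ (y - y') i ≠ 0
  · obtain ⟨i, hij, hi⟩ := h
    exact card_mul_card_coord_eq_dotProduct_eq_zero_le j z _ hij hi
  · push Not at h
    have hj : (y - y') j ≠ 0 := fun h0 => hy <| sub_eq_zero.1 <| funext fun i => by
      by_cases hi : i = j
      · rw [hi, h0, Pi.zero_apply]
      · exact h i hi
    rw [filter_eq_empty_iff.2]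
    · simp
    · rintro x - ⟨hx, hx0⟩
      rw [dotProduct, sum_eq_single j (fun i _ hi => by rw [h i hi, mul_zero]) (by simp), hx] at hx0
      exact mul_ne_zero hz hj hx0

/-- Second moment bound for dot products of a set with the points of a coordinate hyperplane. -/
theorem card_mul_sum_card_dotProduct_collisions_le (E : Finset (ι → F)) (j : ι) {z : F}
    (hz : z ≠ 0) :
    Fintype.card F * ∑ x : ι → F with x j = z,
        ((E ×ˢ E).filter fun p => x ⬝ᵥ p.1 = x ⬝ᵥ p.2).card ≤
      (E.card ^ 2 + Fintype.card F * E.card) * (univ.filter fun x : ι → F => x j = z).card := by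
  set h := (univ.filter fun x : ι → F => x j = z).card
  have hswap : ∑ x : ι → F with x j = z, ((E ×ˢ E).filter fun p => x ⬝ᵥ p.1 = x ⬝ᵥ p.2).card =
      ∑ y ∈ E, ∑ y' ∈ E, (univ.filter fun x : ι → F => x j = z ∧ x ⬝ᵥ y = x ⬝ᵥ y').card := by
    rw [← sum_product']
    simp only [← filter_filter]
    exact sum_card_bipartiteAbove_eq_sum_card_bipartiteBelow _
  calc _ = ∑ y ∈ E, ∑ y' ∈ E, Fintype.card F *
        (univ.filter fun x : ι → F => x j = z ∧ x ⬝ᵥ y = x ⬝ᵥ y').card := by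
        rw [hswap]; simp only [mul_sum]
    _ ≤ ∑ y ∈ E, ∑ y' ∈ E, (h + if y = y' then Fintype.card F * h else 0) := by
        refine sum_le_sum fun y _ => sum_le_sum fun y' _ => ?_
        split_ifs with hy
        · subst hy
          simp [h]
        · exact card_mul_card_coord_eq_dotProduct_eq_le j hz hy
    _ = _ := by
        simp only [sum_add_distrib, sum_const, sum_ite_eq, smul_eq_mul]
        rw [sum_congr rfl fun y hy => if_pos hy, sum_const, smul_eq_mul]
        ring

/-- If all dot products of `A` with `E` lie in `T`, and `A` lies in a coordinate hyperplane
avoiding the origin, then `T` is large. -/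
theorem card_mul_card_mul_sub_card_le (A E : Finset (ι → F)) (T : Finset F) (j : ι) {z : F}
    (hz : z ≠ 0) (hA : ∀ x ∈ A, x j = z) (hT : ∀ x ∈ A, ∀ y ∈ E, x ⬝ᵥ y ∈ T) :
    (A.card * E.card : ℝ) * (Fintype.card F - T.card) ≤
      T.card * (Fintype.card F : ℝ) ^ Fintype.card ι := by
  obtain rfl | hE := E.eq_empty_or_nonempty
  · simp only [card_empty, Nat.cast_zero, mul_zero, zero_mul]
    positivity
  set H := univ.filter fun x : ι → F => x j = z
  set c : (ι → F) → ℕ := fun x => ((E ×ˢ E).filter fun p => x ⬝ᵥ p.1 = x ⬝ᵥ p.2).card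
  have hAH : A ⊆ H := fun x hx => mem_filter.2 ⟨mem_univ _, hA x hx⟩
  have hm : (0 : ℝ) < E.card := by exact_mod_cast hE.card_pos
  have hup : (Fintype.card F : ℝ) * ∑ x ∈ H, (c x : ℝ) ≤
      ((E.card : ℝ) ^ 2 + Fintype.card F * E.card) * H.card := by
    exact_mod_cast card_mul_sum_card_dotProduct_collisions_le E j hz
  have hcard : (Fintype.card F : ℝ) * H.card ≤ (Fintype.card F : ℝ) ^ Fintype.card ι := by
    exact_mod_cast card_mul_card_coord_eq_le j z
  have hlowA : A.card * (E.card : ℝ) ^ 2 ≤ T.card * ∑ x ∈ A, (c x : ℝ) := by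
    rw [mul_sum, ← nsmul_eq_mul]
    refine card_nsmul_le_sum _ _ _ fun x hx => ?_
    exact_mod_cast card_sq_le_card_mul_card_collisions E T (x ⬝ᵥ ·) (hT x hx)
  have hlow : (H \ A).card * (E.card : ℝ) ^ 2 ≤ Fintype.card F * ∑ x ∈ H \ A, (c x : ℝ) := by
    rw [mul_sum, ← nsmul_eq_mul]
    refine card_nsmul_le_sum _ _ _ fun x _ => ?_
    exact_mod_cast card_sq_le_card_mul_card_collisions E univ (x ⬝ᵥ ·) fun _ _ => mem_univ _
  have hsum : ∑ x ∈ H \ A, (c x : ℝ) + ∑ x ∈ A, (c x : ℝ) = ∑ x ∈ H, (c x : ℝ) :=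
    sum_sdiff hAH
  have hsplit : ((H \ A).card : ℝ) + A.card = H.card := by
    exact_mod_cast card_sdiff_add_card_eq_card hAH
  have hAup : Fintype.card F * ∑ x ∈ A, (c x : ℝ) ≤
      A.card * (E.card : ℝ) ^ 2 + E.card * (Fintype.card F : ℝ) ^ Fintype.card ι := by
    have := mul_le_mul_of_nonneg_left hcard hm.le
    rw [← hsum, ← hsplit] at hup
    rw [← hsplit] at this
    linarith
  have h₁ := mul_le_mul_of_nonneg_left hlowA (Nat.cast_nonneg (α := ℝ) (Fintype.card F))
  have h₂ := mul_le_mul_of_nonneg_left hAup (Nat.cast_nonneg (α := ℝ) T.card)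
  refine le_of_mul_le_mul_left ?_ hm
  linarith

end Hyperplane


/-- Pinned dot-product set theorem: if `q` is a prime power, `E ⊆ F_q^d` (`d ≥ 2`),
`z ≠ 0` is the `j`-th coordinate of some point of `E`, and `|E^j_z| * |E| ≥ C q^d`,
then the pinned dot-product set has at least `(C/(C+2)) q` elements. -/
theorem pinned_dot_product_set_card
    (q : ℕ) (Fq : Type*) [Field Fq] [Fintype Fq] [DecidableEq Fq]
    (hcard : Fintype.card Fq = q)
    (d : ℕ) (hd : 2 ≤ d)
    (E : Finset (Fin d → Fq)) (j : Fin d) (z : Fq) (hz0 : z ≠ 0)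
    (hz : ∃ x ∈ E, x j = z)
    (C : ℝ) (hC : 0 < C)
    (hsize : (({y : Fin d → Fq | y j = z ∧ ∃ x ∈ E, ∀ i, i ≠ j → y i = x i}).ncard : ℝ) *
        (E.card : ℝ) ≥ C * (q : ℝ) ^ d) :
    (({t : Fq | ∃ x ∈ {y : Fin d → Fq | y j = z ∧ ∃ x' ∈ E, ∀ i, i ≠ j → y i = x' i},
        ∃ y ∈ E, ∑ i, x i * y i = t}).ncard : ℝ)
      ≥ (C / (C + 2)) * q := by
  classical
  subst hcard
  set A : Set (Fin d → Fq) := {y | y j = z ∧ ∃ x ∈ E, ∀ i, i ≠ j → y i = x i}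
  set T : Set Fq := {t | ∃ x ∈ A, ∃ y ∈ E, ∑ i, x i * y i = t}
  have hkey := card_mul_card_mul_sub_card_le A.toFinset E T.toFinset j hz0
    (fun x hx => (Set.mem_toFinset.1 hx).1)
    (fun x hx y hy => Set.mem_toFinset.2 ⟨x, Set.mem_toFinset.1 hx, y, hy, rfl⟩)
  rw [← Set.ncard_eq_toFinset_card', ← Set.ncard_eq_toFinset_card', Fintype.card_fin] at hkey
  have hTq : (T.ncard : ℝ) ≤ Fintype.card Fq := by
    rw [← Nat.card_eq_fintype_card]
    exact_mod_cast Set.ncard_le_card T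
  have hqd : (0 : ℝ) < (Fintype.card Fq : ℝ) ^ d :=
    pow_pos (by exact_mod_cast Fintype.card_pos) d
  have hC' : C * (Fintype.card Fq - T.ncard) ≤ T.ncard := by
    refine le_of_mul_le_mul_right ?_ hqd
    have := mul_le_mul_of_nonneg_right hsize (sub_nonneg.2 hTq)
    linarith
  rw [ge_iff_le, div_mul_eq_mul_div, div_le_iff₀ (by linarith)]
  linarith [Nat.cast_nonneg (α := ℝ) T.ncard]
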